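/- Let G=(V,E) be a finite simple undirected graph with n nodes, K ≥ 1 an integer, and u ∈ V. Then, for S_0 = ∅, the Shapley past-aware game-theoretic centrality associated with ν_K equals the Shapley game-theoretic centrality and is given by φ^{Sh}_{ν_K}(u) = min{1, K/(deg(u)+1)} + Σ_{v ∈ N(u)} max{deg(v)+1−K, 0} / (deg(v)·(deg(v)+1)). -/

import Mathlib

open Finset

/-- The one-round influence group centrality of `K`-complex contagion:
`ν_K(S) = |S| + |{v ∈ V∖S : |N(v) ∩ S| ≥ K}|`. -/
def nuK {V : Type} [Fintype V] [DecidableEq V] (G : SimpleGraph V) [DecidableRel G.Adj]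
    (K : ℕ) (S : Finset V) : ℝ :=
  (S.card : ℝ) +
    ((univ.filter (fun v => v ∉ S ∧ K ≤ (G.neighborFinset v ∩ S).card)).card : ℝ)

/-- The semivalue past-aware game-theoretic centrality
`φ^β_ν(u|S_0) = C_β · Σ_{s=|S_0|}^{n−1} (β(s)/C(n−1,s)) · Σ_{S ⊆ V∖{u}, |S|=s, S ⊇ S_0} ν(u|S)`,
with `C_β = (Σ_{s=|S_0|}^{n−1} β(s)·C(n−1−|S_0|, s−|S_0|)/C(n−1,s))⁻¹`.
The Shapley case corresponds to the uniform distribution `β(s) = 1/n`. -/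
noncomputable def pagtc {V : Type} [Fintype V] [DecidableEq V]
    (ν : Finset V → ℝ) (β : ℕ → ℝ) (u : V) (S0 : Finset V) : ℝ :=
  (∑ s ∈ Icc S0.card (Fintype.card V - 1),
      β s * ((Fintype.card V - 1 - S0.card).choose (s - S0.card) : ℝ) /
        ((Fintype.card V - 1).choose s : ℝ))⁻¹ *
  ∑ s ∈ Icc S0.card (Fintype.card V - 1),
    β s / ((Fintype.card V - 1).choose s : ℝ) *
      ∑ S ∈ ((univ.erase u).powersetCard s).filter (fun S => S0 ⊆ S),
        (ν (insert u S) - ν S)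

noncomputable def shw (m s : ℕ) : ℝ := 1 / (((m : ℝ) + 1) * (m.choose s : ℝ))

theorem shw_add (m s : ℕ) (h : s ≤ m) : shw (m + 1) s + shw (m + 1) (s + 1) = shw m s := by
  obtain ⟨k, rfl⟩ := Nat.exists_eq_add_of_le h
  have h1 : ((s + k + 1).choose s : ℝ) * ((k : ℝ) + 1) = ((s + k : ℕ) + 1 : ℝ) * ((s + k).choose s : ℝ) := by
    have := Nat.choose_mul_succ_eq (s + k) s
    have e : s + k + 1 - s = k + 1 := by omega
    rw [e] at this
    have h2 : (((s + k).choose s * (s + k + 1) : ℕ) : ℝ) = (((s + k + 1).choose s * (k + 1) : ℕ) : ℝ) := by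
      rw [this]
    push_cast at h2 ⊢
    linarith
  have h3 : ((s + k + 1).choose (s + 1) : ℝ) * ((s : ℝ) + 1) = ((s + k : ℕ) + 1 : ℝ) * ((s + k).choose s : ℝ) := by
    have := Nat.add_one_mul_choose_eq (s + k) s
    have h2 : (((s + k + 1) * (s + k).choose s : ℕ) : ℝ) = (((s + k + 1).choose (s + 1) * (s + 1) : ℕ) : ℝ) := by
      rw [this]
    push_cast at h2 ⊢
    linarith
  have hc : ((s + k).choose s : ℝ) ≠ 0 := by
    exact_mod_cast (Nat.choose_pos (by omega)).ne'
  have hk : (k : ℝ) + 1 ≠ 0 := by positivity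
  have hs : (s : ℝ) + 1 ≠ 0 := by positivity
  have e1 := eq_div_of_mul_eq hk h1
  have e3 := eq_div_of_mul_eq hs h3
  have hsk : (s : ℝ) + k + 1 ≠ 0 := by positivity
  have hsk2 : (s : ℝ) + k + 1 + 1 ≠ 0 := by positivity
  unfold shw
  rw [e1, e3]
  push_cast
  field_simp
  ring

theorem shw_marg {V : Type} [DecidableEq V] (A : Finset V) (f : Finset V → ℝ) (B : Finset V) :
    Disjoint A B →
    ∑ S ∈ (A ∪ B).powerset, shw (A ∪ B).card S.card * f (S ∩ A)
      = ∑ S ∈ A.powerset, shw A.card S.card * f S := by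
  induction B using Finset.induction_on with
  | empty =>
    intro _
    rw [union_empty]
    refine sum_congr rfl fun S hS => ?_
    rw [inter_eq_left.2 (mem_powerset.1 hS)]
  | insert x B hx ih =>
    intro hd
    rw [disjoint_insert_right] at hd
    have hxn : x ∉ A ∪ B := by simp [hx, hd.1]
    rw [union_insert, sum_powerset_insert hxn, ← ih hd.2, ← sum_add_distrib]
    refine sum_congr rfl fun S hS => ?_
    have hS' := mem_powerset.1 hS
    have hxS : x ∉ S := fun h => hxn (hS' h)
    rw [insert_inter_of_notMem hd.1, card_insert_of_notMem hxn, card_insert_of_notMem hxS,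
      ← shw_add _ _ (card_le_card hS')]
    ring

theorem shw_marg' {V : Type} [DecidableEq V] (A U : Finset V) (h : A ⊆ U) (f : Finset V → ℝ) :
    ∑ S ∈ U.powerset, shw U.card S.card * f (S ∩ A)
      = ∑ S ∈ A.powerset, shw A.card S.card * f S := by
  have := shw_marg A f (U \ A) disjoint_sdiff
  rwa [union_sdiff_of_subset h] at this

theorem shw_self {V : Type} [DecidableEq V] (A : Finset V) (K : ℕ) :
    ∑ S ∈ A.powerset, shw A.card S.card * (if S.card < K then 1 else 0)
      = min 1 ((K : ℝ) / ((A.card : ℝ) + 1)) := by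
  rw [sum_powerset_apply_card (fun t => shw A.card t * (if t < K then (1:ℝ) else 0))]
  have : ∀ t ∈ range (A.card + 1), (A.card.choose t) • (shw A.card t * (if t < K then (1:ℝ) else 0))
      = (if t < K then (1:ℝ) else 0) * (1 / ((A.card : ℝ) + 1)) := by
    intro t ht
    have hc : (A.card.choose t : ℝ) ≠ 0 := by
      have := mem_range.1 ht
      exact_mod_cast (Nat.choose_pos (by omega)).ne'
    have : (A.card : ℝ) + 1 ≠ 0 := by positivity
    rw [nsmul_eq_mul, shw]
    field_simp
  rw [sum_congr rfl this, ← sum_mul, sum_boole]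
  have hf : (range (A.card + 1)).filter (fun t => t < K) = range (min (A.card + 1) K) := by
    ext t; simp
  rw [hf, card_range]
  have hp : (0 : ℝ) < (A.card : ℝ) + 1 := by positivity
  rcases le_total (A.card + 1) K with h | h
  · rw [min_eq_left h, min_eq_left]
    · push_cast; field_simp
    · rw [le_div_iff₀ hp]; have : ((A.card + 1 : ℕ) : ℝ) ≤ K := by exact_mod_cast h
      push_cast at this; linarith
  · rw [min_eq_right h, min_eq_right]
    · ring
    · rw [div_le_iff₀ hp]; have : (K : ℝ) ≤ ((A.card + 1 : ℕ) : ℝ) := by exact_mod_cast h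
      push_cast at this; linarith

theorem shw_nbr {V : Type} [DecidableEq V] (A : Finset V) (v : V) (hv : v ∉ A) (K : ℕ)
    (hK : 1 ≤ K) :
    ∑ S ∈ (insert v A).powerset, shw (insert v A).card S.card *
        (if v ∉ S ∧ (S ∩ A).card + 1 = K then 1 else 0)
      = max (((A.card + 1 : ℕ) : ℝ) + 1 - K) 0 /
          (((A.card + 1 : ℕ) : ℝ) * (((A.card + 1 : ℕ) : ℝ) + 1)) := by
  obtain ⟨k, rfl⟩ := Nat.exists_eq_add_of_le' hK
  rw [sum_powerset_insert hv]
  have h2 : ∑ S ∈ A.powerset, shw (insert v A).card (insert v S).card *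
        (if v ∉ insert v S ∧ (insert v S ∩ A).card + 1 = k + 1 then (1:ℝ) else 0) = 0 := by
    refine sum_eq_zero fun S _ => ?_
    simp
  rw [h2, add_zero, card_insert_of_notMem hv]
  have h3 : ∀ S ∈ A.powerset, shw (A.card + 1) S.card *
        (if v ∉ S ∧ (S ∩ A).card + 1 = k + 1 then (1:ℝ) else 0)
      = (fun t => if t = k then shw (A.card + 1) k else 0) S.card := by
    intro S hS
    have hS' := mem_powerset.1 hS
    have hvS : v ∉ S := fun h => hv (hS' h)
    rw [inter_eq_left.2 hS']
    by_cases h : S.card = k <;> simp [h, hvS]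
  rw [sum_congr rfl h3,
    sum_powerset_apply_card (fun t => if t = k then shw (A.card + 1) k else 0)]
  simp only [smul_ite, smul_zero, sum_ite_eq', mem_range]
  split_ifs with h
  · have hka : k ≤ A.card := by omega
    obtain ⟨j, hj⟩ := Nat.exists_eq_add_of_le hka
    rw [hj]
    have hh := Nat.choose_mul_succ_eq (k + j) k
    have e : k + j + 1 - k = j + 1 := by omega
    rw [e] at hh
    have hh2 : (((k + j).choose k * (k + j + 1) : ℕ) : ℝ) = (((k + j + 1).choose k * (j + 1) : ℕ) : ℝ) := by
      rw [hh]
    push_cast at hh2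
    have hc : ((k + j + 1).choose k : ℝ) ≠ 0 := by
      exact_mod_cast (Nat.choose_pos (by omega)).ne'
    have hm : max (((k + j + 1 : ℕ) : ℝ) + 1 - ((k + 1 : ℕ) : ℝ)) 0 = (j : ℝ) + 1 := by
      rw [max_eq_left] <;> push_cast
      · ring
      · have : (0 : ℝ) ≤ j := by positivity
        linarith
    rw [hm, nsmul_eq_mul, shw]
    have a1 : (k : ℝ) + j + 1 ≠ 0 := by positivity
    have a2 : (k : ℝ) + j + 1 + 1 ≠ 0 := by positivity
    push_cast
    rw [mul_one_div, div_eq_div_iff (by positivity) (by positivity)]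
    linear_combination ((k : ℝ) + j + 1 + 1) * hh2
  · have hka : A.card + 1 ≤ k := by omega
    have : ((A.card + 1 : ℕ) : ℝ) ≤ k := by exact_mod_cast hka
    rw [max_eq_right, zero_div]
    push_cast at this ⊢
    linarith

theorem nuK_marg {V : Type} [Fintype V] [DecidableEq V] (G : SimpleGraph V)
    [DecidableRel G.Adj] (K : ℕ) (u : V) (S : Finset V) (hu : u ∉ S) :
    nuK G K (insert u S) - nuK G K S =
      (if (G.neighborFinset u ∩ S).card < K then 1 else 0) +
      ∑ v ∈ G.neighborFinset u,
        (if v ∉ S ∧ (G.neighborFinset v ∩ S).card + 1 = K then (1:ℝ) else 0) := by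
  unfold nuK
  rw [card_insert_of_notMem hu]
  have key : ∀ v : V,
      (if v ∉ insert u S ∧ K ≤ (G.neighborFinset v ∩ insert u S).card then (1:ℝ) else 0)
      = (if v ∉ S ∧ K ≤ (G.neighborFinset v ∩ S).card then (1:ℝ) else 0)
        + ((if v = u then -(if K ≤ (G.neighborFinset u ∩ S).card then (1:ℝ) else 0) else 0)
        + (if v ∈ G.neighborFinset u then
          (if v ∉ S ∧ (G.neighborFinset v ∩ S).card + 1 = K then (1:ℝ) else 0) else 0)) := by
    intro v
    by_cases hvu : v = u
    · subst hvu
      simp [hu]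
    · by_cases hadj : G.Adj u v
      · have h1 : u ∈ G.neighborFinset v := by simpa using hadj.symm
        have h2 : u ∉ G.neighborFinset v ∩ S := by simp [hu]
        rw [inter_insert_of_mem h1, card_insert_of_notMem h2]
        have h3 : v ∈ G.neighborFinset u := by simpa using hadj
        simp only [h3, hvu, mem_insert, false_or, if_true, if_false]
        by_cases hvS : v ∈ S
        · simp [hvS]
        · simp only [hvS, not_false_eq_true, true_and]
          split_ifs <;> first | omega | norm_num
      · have h1 : u ∉ G.neighborFinset v := by simpa using fun h => hadj (SimpleGraph.Adj.symm h)
        have h3 : v ∉ G.neighborFinset u := by simpa using hadj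
        rw [inter_insert_of_notMem h1]
        simp [h3, hvu]
  rw [card_filter, card_filter]
  push_cast
  rw [sum_congr rfl fun v _ => key v, sum_add_distrib, sum_add_distrib, sum_ite_eq',
    sum_ite_mem, univ_inter]
  simp only [mem_univ, if_true]
  have : (if (G.neighborFinset u ∩ S).card < K then (1:ℝ) else 0)
      = 1 - (if K ≤ (G.neighborFinset u ∩ S).card then (1:ℝ) else 0) := by
    split_ifs <;> first | omega | norm_num
  rw [this]
  ring

theorem sh_eq {V : Type} [Fintype V] [DecidableEq V] (G : SimpleGraph V)
    [DecidableRel G.Adj] (K : ℕ) (hK : 1 ≤ K) (u : V) :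
    ∑ s ∈ range (Fintype.card V),
          1 / (Fintype.card V : ℝ) * (1 / ((Fintype.card V - 1).choose s : ℝ)) *
            ∑ S ∈ (univ.erase u).powersetCard s, (nuK G K (insert u S) - nuK G K S)
      = min 1 ((K : ℝ) / ((G.degree u : ℝ) + 1))
        + ∑ v ∈ G.neighborFinset u,
            max ((G.degree v : ℝ) + 1 - (K : ℝ)) 0 /
              ((G.degree v : ℝ) * ((G.degree v : ℝ) + 1)) := by
  have hcard : (univ.erase u).card + 1 = Fintype.card V := by
    rw [card_erase_add_one (mem_univ u), card_univ]
  have hL : ∑ s ∈ range (Fintype.card V),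
          1 / (Fintype.card V : ℝ) * (1 / ((Fintype.card V - 1).choose s : ℝ)) *
            ∑ S ∈ (univ.erase u).powersetCard s, (nuK G K (insert u S) - nuK G K S)
      = ∑ S ∈ (univ.erase u).powerset, shw (univ.erase u).card S.card *
          (nuK G K (insert u S) - nuK G K S) := by
    rw [sum_powerset, hcard.symm]
    refine sum_congr rfl fun s _ => ?_
    rw [mul_sum]
    refine sum_congr rfl fun S hS => ?_
    rw [(mem_powersetCard.1 hS).2, shw, Nat.add_sub_cancel]
    push_cast
    rw [one_div_mul_one_div]
  rw [hL]
  have hM : ∀ S ∈ (univ.erase u).powerset, shw (univ.erase u).card S.card *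
          (nuK G K (insert u S) - nuK G K S)
      = shw (univ.erase u).card S.card *
          (fun T : Finset V => if T.card < K then (1:ℝ) else 0) (S ∩ G.neighborFinset u)
        + ∑ v ∈ G.neighborFinset u, shw (univ.erase u).card S.card *
          (fun T : Finset V => if v ∉ T ∧ (T ∩ (G.neighborFinset v).erase u).card + 1 = K
            then (1:ℝ) else 0) (S ∩ insert v ((G.neighborFinset v).erase u)) := by
    intro S hS
    have hu : u ∉ S := fun h => by simpa using mem_powerset.1 hS h
    rw [nuK_marg G K u S hu, mul_add, mul_sum]
    congr 1
    · rw [inter_comm]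
    · refine sum_congr rfl fun v _ => ?_
      have e1 : (S ∩ insert v ((G.neighborFinset v).erase u)) ∩ (G.neighborFinset v).erase u
          = G.neighborFinset v ∩ S := by
        ext x
        simp only [mem_inter, mem_insert, mem_erase]
        constructor
        · tauto
        · rintro ⟨h1, h2⟩
          have : x ≠ u := fun h => hu (h ▸ h2)
          tauto
      simp only [e1]
      simp
  rw [sum_congr rfl hM, sum_add_distrib, sum_comm]
  congr 1
  · refine (shw_marg' (G.neighborFinset u) _ ?_ _).trans
      ((shw_self _ K).trans (by rw [SimpleGraph.card_neighborFinset_eq_degree]))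
    intro x hx
    have : G.Adj u x := by simpa using hx
    simpa using this.ne'
  · refine sum_congr rfl fun v hv => ?_
    have hadj : G.Adj u v := by simpa using hv
    have hd : ((G.neighborFinset v).erase u).card + 1 = G.degree v := by
      rw [card_erase_add_one (by simpa using hadj.symm), SimpleGraph.card_neighborFinset_eq_degree]
    refine (shw_marg' (insert v ((G.neighborFinset v).erase u)) _ ?_ _).trans
      ((shw_nbr _ v (by simp) K hK).trans (by rw [hd]))
    intro x hx
    rw [mem_insert, mem_erase] at hx
    have : x ≠ u := by
      rcases hx with h | h
      · rw [h]; exact hadj.ne'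
      · exact h.1
    simpa using this

theorem pagtc_eq {V : Type} [Fintype V] [DecidableEq V] (ν : Finset V → ℝ) (u : V) :
    pagtc ν (fun _ => 1 / (Fintype.card V : ℝ)) u ∅
      = ∑ s ∈ range (Fintype.card V),
          1 / (Fintype.card V : ℝ) * (1 / ((Fintype.card V - 1).choose s : ℝ)) *
            ∑ S ∈ (univ.erase u).powersetCard s, (ν (insert u S) - ν S) := by
  have hn : 0 < Fintype.card V := Fintype.card_pos_iff.2 ⟨u⟩
  have hI : Icc 0 (Fintype.card V - 1) = range (Fintype.card V) := by
    ext x; simp only [mem_Icc, mem_range]; omega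
  have hn' : (Fintype.card V : ℝ) ≠ 0 := by exact_mod_cast hn.ne'
  unfold pagtc
  simp only [card_empty, hI, Nat.sub_zero, empty_subset, filter_true]
  have h1 : ∑ s ∈ range (Fintype.card V),
      1 / (Fintype.card V : ℝ) * ((Fintype.card V - 1).choose s : ℝ) /
        ((Fintype.card V - 1).choose s : ℝ) = 1 := by
    have : ∀ s ∈ range (Fintype.card V), 1 / (Fintype.card V : ℝ) * ((Fintype.card V - 1).choose s : ℝ) /
        ((Fintype.card V - 1).choose s : ℝ) = 1 / (Fintype.card V : ℝ) := by
      intro s hs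
      have := mem_range.1 hs
      have hc : ((Fintype.card V - 1).choose s : ℝ) ≠ 0 := by
        exact_mod_cast (Nat.choose_pos (by omega)).ne'
      rw [mul_div_assoc, div_self hc, mul_one]
    rw [sum_congr rfl this, sum_const, card_range, nsmul_eq_mul]
    field_simp
  rw [h1, inv_one, one_mul]
  refine sum_congr rfl fun s _ => ?_
  rw [mul_one_div]

/-- Theorem: for `S_0 = ∅` the Shapley past-aware game-theoretic centrality associated with
`ν_K` equals the Shapley game-theoretic centrality
`φ^Sh_{ν_K}(u) = Σ_{s=0}^{n−1} (1/n)·(1/C(n−1,s)) · Σ_{S ⊆ V∖{u}, |S|=s} ν_K(u|S)`, and is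
given by
`φ^Sh_{ν_K}(u) = min{1, K/(deg(u)+1)} + Σ_{v ∈ N(u)} max{deg(v)+1−K, 0}/(deg(v)·(deg(v)+1))`. -/
theorem stmt8 {V : Type} [Fintype V] [DecidableEq V] (G : SimpleGraph V)
    [DecidableRel G.Adj] (K : ℕ) (hK : 1 ≤ K) (u : V) :
    pagtc (nuK G K) (fun _ => 1 / (Fintype.card V : ℝ)) u ∅
      = ∑ s ∈ range (Fintype.card V),
          1 / (Fintype.card V : ℝ) * (1 / ((Fintype.card V - 1).choose s : ℝ)) *
            ∑ S ∈ (univ.erase u).powersetCard s, (nuK G K (insert u S) - nuK G K S)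
    ∧ pagtc (nuK G K) (fun _ => 1 / (Fintype.card V : ℝ)) u ∅
      = min 1 ((K : ℝ) / ((G.degree u : ℝ) + 1))
        + ∑ v ∈ G.neighborFinset u,
            max ((G.degree v : ℝ) + 1 - (K : ℝ)) 0 /
              ((G.degree v : ℝ) * ((G.degree v : ℝ) + 1)) := by
  exact ⟨pagtc_eq _ u, (pagtc_eq _ u).trans (sh_eq G K hK u)⟩
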